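/- arXiv:2403.11365 — 6 statements merged into one kernel-verified Lean document; each statement's English description precedes it below -/
import Mathlib

section
/- Let φ₁, φ₂, φ₃ and b₁, b₂ be real numbers, and set Sᵢ = (b₁−cos φᵢ)² + (b₂−sin φᵢ)² for i = 1,2,3. Then the determinant of the 3×3 matrix whose i-th row is (Sᵢ, b₁−cos φᵢ, b₂−sin φᵢ) equals (b₁² + b₂² − 1)[sin(φ₁−φ₂) − sin(φ₁−φ₃) + sin(φ₂−φ₃)]. -/
open Real

/-- The determinant of the 3×3 matrix whose `i`-th row is `(Sᵢ, b₁−cos φᵢ, b₂−sin φᵢ)`,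
where `Sᵢ = (b₁−cos φᵢ)² + (b₂−sin φᵢ)²`, equals
`(b₁² + b₂² − 1)[sin(φ₁−φ₂) − sin(φ₁−φ₃) + sin(φ₂−φ₃)]`. -/
theorem det_S_matrix (φ₁ φ₂ φ₃ b₁ b₂ : ℝ) (S₁ S₂ S₃ : ℝ)
    (hS₁ : S₁ = (b₁ - Real.cos φ₁) ^ 2 + (b₂ - Real.sin φ₁) ^ 2)
    (hS₂ : S₂ = (b₁ - Real.cos φ₂) ^ 2 + (b₂ - Real.sin φ₂) ^ 2)
    (hS₃ : S₃ = (b₁ - Real.cos φ₃) ^ 2 + (b₂ - Real.sin φ₃) ^ 2) :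
    Matrix.det !![S₁, b₁ - Real.cos φ₁, b₂ - Real.sin φ₁;
                  S₂, b₁ - Real.cos φ₂, b₂ - Real.sin φ₂;
                  S₃, b₁ - Real.cos φ₃, b₂ - Real.sin φ₃] =
      (b₁ ^ 2 + b₂ ^ 2 - 1) *
        (Real.sin (φ₁ - φ₂) - Real.sin (φ₁ - φ₃) + Real.sin (φ₂ - φ₃)) := by
  have sq_dist (φ : ℝ) : (b₁ - cos φ) ^ 2 + (b₂ - sin φ) ^ 2 =
      2 * b₁ * (b₁ - cos φ) + 2 * b₂ * (b₂ - sin φ) + (1 - b₁ ^ 2 - b₂ ^ 2) := by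
    linear_combination sin_sq_add_cos_sq φ
  simp only [Matrix.det_fin_three, Matrix.of_apply, Matrix.cons_val]
  rw [hS₁, hS₂, hS₃, sq_dist φ₁, sq_dist φ₂, sq_dist φ₃,
    sin_sub, sin_sub, sin_sub]
  ring
end

section
/- Let φ₁, φ₂, φ₃ be real numbers that are pairwise distinct modulo 2π, let A ≠ 0, and let (b₁,b₂) satisfy b₁² + b₂² < 1. Set Sᵢ = (b₁−cos φᵢ)² + (b₂−sin φᵢ)², and let D𝒜 be the 3×3 matrix whose i-th row is (1/Sᵢ², −4A(b₁−cos φᵢ)/Sᵢ³, −4A(b₂−sin φᵢ)/Sᵢ³). Then det(D𝒜) ≠ 0; that is, the Jacobian of the forward map is nonsingular at every anomaly center strictly inside the unit disc. -/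
open Real

/-- The squared determinant of the three points `(1, cᵢ, sᵢ)` of the light cone over the unit
circle, in terms of their pairwise Lorentz products. -/
lemma sq_det_unit_circle {c₁ c₂ c₃ s₁ s₂ s₃ : ℝ}
    (h₁ : c₁ ^ 2 + s₁ ^ 2 = 1) (h₂ : c₂ ^ 2 + s₂ ^ 2 = 1) (h₃ : c₃ ^ 2 + s₃ ^ 2 = 1) :
    ((c₂ - c₁) * (s₃ - s₁) - (c₃ - c₁) * (s₂ - s₁)) ^ 2 =
      2 * (1 - (c₁ * c₂ + s₁ * s₂)) * (1 - (c₂ * c₃ + s₂ * s₃)) *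
        (1 - (c₃ * c₁ + s₃ * s₁)) := by
  linear_combination
    ((c₂ * c₃ + s₂ * s₃ - 1) ^ 2 - (c₂ ^ 2 + s₂ ^ 2 - 1) * (c₃ ^ 2 + s₃ ^ 2 - 1)) * h₁ +
    (c₃ * c₁ + s₃ * s₁ - 1) ^ 2 * h₂ + (c₁ * c₂ + s₁ * s₂ - 1) ^ 2 * h₃

lemma one_sub_cos_sub_ne_zero {α β : ℝ} (h : ∀ n : ℤ, α - β ≠ 2 * π * n) :
    1 - (cos α * cos β + sin α * sin β) ≠ 0 := by
  rw [← cos_sub, sub_ne_zero]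
  intro h_cos
  obtain ⟨n, hn⟩ := (cos_eq_one_iff _).mp h_cos.symm
  exact h n (by rw [← hn, mul_comm])

lemma sq_dist_unit_circle_ne_zero {b₁ b₂ : ℝ} (hb : b₁ ^ 2 + b₂ ^ 2 < 1) (φ : ℝ) :
    (b₁ - cos φ) ^ 2 + (b₂ - sin φ) ^ 2 ≠ 0 := by
  intro h
  have hc : b₁ = cos φ := by nlinarith [sq_nonneg (b₁ - cos φ), sq_nonneg (b₂ - sin φ)]
  have hs : b₂ = sin φ := by nlinarith [sq_nonneg (b₁ - cos φ), sq_nonneg (b₂ - sin φ)]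
  rw [hc, hs, cos_sq_add_sin_sq] at hb
  exact lt_irrefl _ hb

/-- If the measurement angles `φ₁, φ₂, φ₃` are pairwise distinct modulo `2π`, `A ≠ 0`, and
the anomaly center `(b₁,b₂)` lies strictly inside the unit disc, then the Jacobian `D𝒜`
of the forward map, whose `i`-th row is
`(1/Sᵢ², −4A(b₁−cos φᵢ)/Sᵢ³, −4A(b₂−sin φᵢ)/Sᵢ³)`, is nonsingular. -/
theorem det_jacobian_ne_zero (φ₁ φ₂ φ₃ b₁ b₂ A : ℝ)
    (h₁₂ : ∀ n : ℤ, φ₁ - φ₂ ≠ 2 * π * n)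
    (h₂₃ : ∀ n : ℤ, φ₂ - φ₃ ≠ 2 * π * n)
    (h₃₁ : ∀ n : ℤ, φ₃ - φ₁ ≠ 2 * π * n)
    (hA : A ≠ 0) (hb : b₁ ^ 2 + b₂ ^ 2 < 1)
    (S₁ S₂ S₃ : ℝ)
    (hS₁ : S₁ = (b₁ - Real.cos φ₁) ^ 2 + (b₂ - Real.sin φ₁) ^ 2)
    (hS₂ : S₂ = (b₁ - Real.cos φ₂) ^ 2 + (b₂ - Real.sin φ₂) ^ 2)
    (hS₃ : S₃ = (b₁ - Real.cos φ₃) ^ 2 + (b₂ - Real.sin φ₃) ^ 2) :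
    Matrix.det
        !![1 / S₁ ^ 2, -4 * A * (b₁ - Real.cos φ₁) / S₁ ^ 3,
             -4 * A * (b₂ - Real.sin φ₁) / S₁ ^ 3;
           1 / S₂ ^ 2, -4 * A * (b₁ - Real.cos φ₂) / S₂ ^ 3,
             -4 * A * (b₂ - Real.sin φ₂) / S₂ ^ 3;
           1 / S₃ ^ 2, -4 * A * (b₁ - Real.cos φ₃) / S₃ ^ 3,
             -4 * A * (b₂ - Real.sin φ₃) / S₃ ^ 3] ≠ 0 := by
  have hn₁ : S₁ ≠ 0 := hS₁ ▸ sq_dist_unit_circle_ne_zero hb φ₁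
  have hn₂ : S₂ ≠ 0 := hS₂ ▸ sq_dist_unit_circle_ne_zero hb φ₂
  have hn₃ : S₃ ≠ 0 := hS₃ ▸ sq_dist_unit_circle_ne_zero hb φ₃
  have hD : (cos φ₂ - cos φ₁) * (sin φ₃ - sin φ₁) -
      (cos φ₃ - cos φ₁) * (sin φ₂ - sin φ₁) ≠ 0 := by
    rw [← pow_ne_zero_iff two_ne_zero, sq_det_unit_circle (cos_sq_add_sin_sq φ₁)
      (cos_sq_add_sin_sq φ₂) (cos_sq_add_sin_sq φ₃)]
    exact mul_ne_zero (mul_ne_zero (mul_ne_zero two_ne_zero (one_sub_cos_sub_ne_zero h₁₂))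
      (one_sub_cos_sub_ne_zero h₂₃)) (one_sub_cos_sub_ne_zero h₃₁)
  have hT₁ : S₁ = 1 + b₁ ^ 2 + b₂ ^ 2 - 2 * b₁ * cos φ₁ - 2 * b₂ * sin φ₁ := by
    linear_combination hS₁ + cos_sq_add_sin_sq φ₁
  have hT₂ : S₂ = 1 + b₁ ^ 2 + b₂ ^ 2 - 2 * b₁ * cos φ₂ - 2 * b₂ * sin φ₂ := by
    linear_combination hS₂ + cos_sq_add_sin_sq φ₂
  have hT₃ : S₃ = 1 + b₁ ^ 2 + b₂ ^ 2 - 2 * b₁ * cos φ₃ - 2 * b₂ * sin φ₃ := by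
    linear_combination hS₃ + cos_sq_add_sin_sq φ₃
  have h_num : S₁ * ((b₁ - cos φ₂) * (b₂ - sin φ₃) - (b₂ - sin φ₂) * (b₁ - cos φ₃)) -
      S₂ * ((b₁ - cos φ₁) * (b₂ - sin φ₃) - (b₂ - sin φ₁) * (b₁ - cos φ₃)) +
      S₃ * ((b₁ - cos φ₁) * (b₂ - sin φ₂) - (b₂ - sin φ₁) * (b₁ - cos φ₂)) =
      (1 - (b₁ ^ 2 + b₂ ^ 2)) * ((cos φ₂ - cos φ₁) * (sin φ₃ - sin φ₁) -
        (cos φ₃ - cos φ₁) * (sin φ₂ - sin φ₁)) := by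
    rw [hT₁, hT₂, hT₃]
    ring
  have h_ne := mul_ne_zero (sub_pos.mpr hb).ne' hD
  rw [← h_num] at h_ne
  clear hS₁ hS₂ hS₃ hT₁ hT₂ hT₃ h_num
  have h_det := mul_ne_zero (div_ne_zero (mul_ne_zero (by norm_num : (16 : ℝ) ≠ 0)
    (pow_ne_zero 2 hA)) (pow_ne_zero 3 (mul_ne_zero (mul_ne_zero hn₁ hn₂) hn₃))) h_ne
  convert h_det using 1
  rw [Matrix.det_fin_three]
  simp only [Matrix.of_apply, Matrix.cons_val]
  field_simp
  ring
end

section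
/- Let φ₁, φ₂, φ₃ be real numbers that are pairwise distinct modulo 2π. Define, for A > 0 and (b₁,b₂) with b₁² + b₂² < 1, the forward map 𝒜(A,b₁,b₂) = (A K(b₁,b₂;φ₁), A K(b₁,b₂;φ₂), A K(b₁,b₂;φ₃)), where K(b₁,b₂;φ) = 1/((b₁−cos φ)² + (b₂−sin φ)²)². If A, A′ > 0, b₁² + b₂² < 1, b₁′² + b₂′² < 1, and 𝒜(A,b₁,b₂) = 𝒜(A′,b₁′,b₂′), then A = A′, b₁ = b₁′, and b₂ = b₂′. That is, the anomaly location and size are uniquely determined by dipole measurements at three distinct boundary angles. -/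
open Real

/-- The dipole measurement kernel `K(b₁,b₂;φ) = 1/((b₁−cos φ)² + (b₂−sin φ)²)²`. -/
noncomputable def dipoleKernel (b₁ b₂ φ : ℝ) : ℝ :=
  1 / (((b₁ - Real.cos φ) ^ 2 + (b₂ - Real.sin φ) ^ 2) ^ 2)

/-- Angles that differ modulo `2π` give distinct points of the unit circle. -/
lemma not_cos_eq_and_sin_eq {φ ψ : ℝ} (h : ∀ n : ℤ, φ - ψ ≠ 2 * π * n) :
    ¬ (cos φ = cos ψ ∧ sin φ = sin ψ) := by
  rintro ⟨hc, hs⟩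
  have h1 : cos (φ - ψ) = 1 := by
    rw [cos_sub, hc, hs]
    linear_combination cos_sq_add_sin_sq ψ
  obtain ⟨n, hn⟩ := (cos_eq_one_iff _).1 h1
  exact h n (by rw [← hn]; ring)

/-- Two points of the unit circle on a common line `c + p x + q y = 0` have the same or opposite
position along that line. -/
lemma line_coord_eq_or_eq_neg {c p q x y x' y' : ℝ}
    (h : x ^ 2 + y ^ 2 = 1) (h' : x' ^ 2 + y' ^ 2 = 1)
    (e : c + p * x + q * y = 0) (e' : c + p * x' + q * y' = 0) :
    p * y - q * x = p * y' - q * x' ∨ p * y - q * x = -(p * y' - q * x') := by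
  apply sq_eq_sq_iff_eq_or_eq_neg.1
  linear_combination (p ^ 2 + q ^ 2) * h - (p ^ 2 + q ^ 2) * h'
    - (p * x + q * y - c) * e + (p * x' + q * y' - c) * e'

/-- A point of a nondegenerate line is determined by its position along the line. -/
lemma eq_of_line_coord_eq {c p q x y x' y' : ℝ} (hpq : p ^ 2 + q ^ 2 ≠ 0)
    (e : c + p * x + q * y = 0) (e' : c + p * x' + q * y' = 0)
    (h : p * y - q * x = p * y' - q * x') : x = x' ∧ y = y' := by
  constructor <;> apply mul_left_cancel₀ hpq
  · linear_combination p * e - p * e' - q * h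
  · linear_combination q * e - q * e' + p * h

/-- An affine function vanishing at three distinct points of the unit circle is zero. -/
lemma affine_eq_zero_of_three_circle_points {c p q x₁ y₁ x₂ y₂ x₃ y₃ : ℝ}
    (h1 : x₁ ^ 2 + y₁ ^ 2 = 1) (h2 : x₂ ^ 2 + y₂ ^ 2 = 1) (h3 : x₃ ^ 2 + y₃ ^ 2 = 1)
    (h₁₂ : ¬ (x₁ = x₂ ∧ y₁ = y₂)) (h₂₃ : ¬ (x₂ = x₃ ∧ y₂ = y₃)) (h₃₁ : ¬ (x₃ = x₁ ∧ y₃ = y₁))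
    (e1 : c + p * x₁ + q * y₁ = 0) (e2 : c + p * x₂ + q * y₂ = 0)
    (e3 : c + p * x₃ + q * y₃ = 0) : c = 0 ∧ p = 0 ∧ q = 0 := by
  by_cases hpq : p ^ 2 + q ^ 2 = 0
  · have hp : p = 0 := by nlinarith [sq_nonneg p, sq_nonneg q]
    have hq : q = 0 := by nlinarith [sq_nonneg p, sq_nonneg q]
    subst hp hq
    exact ⟨by linarith, rfl, rfl⟩
  · exfalso
    rcases line_coord_eq_or_eq_neg h1 h2 e1 e2 with h | h
    · exact h₁₂ (eq_of_line_coord_eq hpq e1 e2 h)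
    rcases line_coord_eq_or_eq_neg h2 h3 e2 e3 with h' | h'
    · exact h₂₃ (eq_of_line_coord_eq hpq e2 e3 h')
    exact h₃₁ (eq_of_line_coord_eq hpq e3 e1 (by linarith))

/-- The squared distance from a point inside the unit disc to a boundary point is positive. -/
lemma dist_sq_boundary_pos {b₁ b₂ : ℝ} (hb : b₁ ^ 2 + b₂ ^ 2 < 1) (φ : ℝ) :
    0 < (b₁ - cos φ) ^ 2 + (b₂ - sin φ) ^ 2 := by
  by_contra hle
  have h1 : b₁ - cos φ = 0 := by nlinarith [sq_nonneg (b₁ - cos φ), sq_nonneg (b₂ - sin φ)]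
  have h2 : b₂ - sin φ = 0 := by nlinarith [sq_nonneg (b₁ - cos φ), sq_nonneg (b₂ - sin φ)]
  rw [sub_eq_zero.1 h1, sub_eq_zero.1 h2, cos_sq_add_sin_sq] at hb
  exact lt_irrefl _ hb

/-- Equal measurements at one angle give an affine relation in the boundary point. -/
lemma affine_relation_of_measurement_eq {s t b₁ b₂ b₁' b₂' φ : ℝ} (hs : 0 < s) (ht : 0 < t)
    (hb : b₁ ^ 2 + b₂ ^ 2 < 1) (hb' : b₁' ^ 2 + b₂' ^ 2 < 1)
    (h : s ^ 2 * dipoleKernel b₁ b₂ φ = t ^ 2 * dipoleKernel b₁' b₂' φ) :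
    (s * (1 + b₁' ^ 2 + b₂' ^ 2) - t * (1 + b₁ ^ 2 + b₂ ^ 2))
      + (-2 * (s * b₁' - t * b₁)) * cos φ + (-2 * (s * b₂' - t * b₂)) * sin φ = 0 := by
  have hd := dist_sq_boundary_pos hb φ
  have hd' := dist_sq_boundary_pos hb' φ
  unfold dipoleKernel at h
  rw [mul_one_div, mul_one_div, div_eq_div_iff (by positivity) (by positivity),
    ← mul_pow, ← mul_pow] at h
  have key := (pow_left_inj₀ (by positivity) (by positivity) two_ne_zero).1 h
  linear_combination key - (s - t) * cos_sq_add_sin_sq φ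

/-- Uniqueness: if the measurement angles `φ₁, φ₂, φ₃` are pairwise distinct modulo `2π`,
then the forward map `𝒜(A,b₁,b₂) = (A·K(b₁,b₂;φᵢ))ᵢ` is injective on positive areas `A`
and centers strictly inside the unit disc: the anomaly location and size are uniquely
determined by the three dipole measurements. -/
theorem forward_map_injective (φ₁ φ₂ φ₃ : ℝ)
    (h₁₂ : ∀ n : ℤ, φ₁ - φ₂ ≠ 2 * π * n)
    (h₂₃ : ∀ n : ℤ, φ₂ - φ₃ ≠ 2 * π * n)
    (h₃₁ : ∀ n : ℤ, φ₃ - φ₁ ≠ 2 * π * n)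
    (A A' b₁ b₂ b₁' b₂' : ℝ) (hA : 0 < A) (hA' : 0 < A')
    (hb : b₁ ^ 2 + b₂ ^ 2 < 1) (hb' : b₁' ^ 2 + b₂' ^ 2 < 1)
    (h1 : A * dipoleKernel b₁ b₂ φ₁ = A' * dipoleKernel b₁' b₂' φ₁)
    (h2 : A * dipoleKernel b₁ b₂ φ₂ = A' * dipoleKernel b₁' b₂' φ₂)
    (h3 : A * dipoleKernel b₁ b₂ φ₃ = A' * dipoleKernel b₁' b₂' φ₃) :
    A = A' ∧ b₁ = b₁' ∧ b₂ = b₂' := by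
  obtain ⟨s, hs, rfl⟩ : ∃ s : ℝ, 0 < s ∧ s ^ 2 = A := ⟨√A, sqrt_pos.2 hA, sq_sqrt hA.le⟩
  obtain ⟨t, ht, rfl⟩ : ∃ t : ℝ, 0 < t ∧ t ^ 2 = A' := ⟨√A', sqrt_pos.2 hA', sq_sqrt hA'.le⟩
  obtain ⟨hc, hp, hq⟩ := affine_eq_zero_of_three_circle_points
    (cos_sq_add_sin_sq φ₁) (cos_sq_add_sin_sq φ₂) (cos_sq_add_sin_sq φ₃)
    (not_cos_eq_and_sin_eq h₁₂) (not_cos_eq_and_sin_eq h₂₃) (not_cos_eq_and_sin_eq h₃₁)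
    (affine_relation_of_measurement_eq hs ht hb hb' h1)
    (affine_relation_of_measurement_eq hs ht hb hb' h2)
    (affine_relation_of_measurement_eq hs ht hb hb' h3)
  have e1 : s * b₁' = t * b₁ := by linarith
  have e2 : s * b₂' = t * b₂ := by linarith
  have hfac : (s - t) * (s - t * (b₁ ^ 2 + b₂ ^ 2)) = 0 := by
    linear_combination s * hc - (s * b₁' + t * b₁) * e1 - (s * b₂' + t * b₂) * e2
  rcases mul_eq_zero.1 hfac with h | h
  · obtain rfl : s = t := by linarith
    exact ⟨rfl, (mul_left_cancel₀ hs.ne' e1).symm, (mul_left_cancel₀ hs.ne' e2).symm⟩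
  · exfalso
    have hst : s < t := by nlinarith
    have hr : s * (b₁' ^ 2 + b₂' ^ 2) = t := by
      linear_combination hc - h
    nlinarith
end

section
/- Let φ₁, φ₂, φ₃ and b₁ be real numbers; set b₂ = 0, Sᵢ = (b₁−cos φᵢ)² + sin²φᵢ, and define J₁ = −2(b₁−cos φ₁)S₃ + 2(b₁−cos φ₃)S₁, J₂ = 2 sin φ₁ · S₃ − 2 sin φ₃ · S₁, J₃ = −2(b₁−cos φ₂)S₃ + 2(b₁−cos φ₃)S₂, J₄ = 2 sin φ₂ · S₃ − 2 sin φ₃ · S₂. Then J₁J₄ − J₂J₃ = 16(1 − b₁²) sin((φ₁−φ₂)/2) sin((φ₂−φ₃)/2) sin((φ₃−φ₁)/2) · S₃. -/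
open Real

/-- The product of the sines of the half-differences of three angles, as twice the signed area of
the triangle that the angles span on the unit circle. -/
theorem four_mul_sin_half_sub_mul_sin_half_sub_mul_sin_half_sub (x y z : ℝ) :
    4 * (sin ((x - y) / 2) * sin ((y - z) / 2) * sin ((z - x) / 2)) =
      (cos x - cos z) * (sin y - sin z) - (sin x - sin z) * (cos y - cos z) := by
  have hxz : (z - x) / 2 = -((x - z) / 2) := by ring
  have hxy : (x - y) / 2 = (x + z) / 2 - (y + z) / 2 := by ring
  rw [cos_sub_cos, cos_sub_cos, sin_sub_sin, sin_sub_sin, hxz, sin_neg, hxy, sin_sub]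
  ring

/-- The squared distance from `(b, 0)` to a point of the unit circle is affine in its abscissa. -/
theorem sub_cos_sq_add_sin_sq (b x : ℝ) :
    (b - cos x) ^ 2 + sin x ^ 2 = 1 + b ^ 2 - 2 * b * cos x := by
  rw [sin_sq]
  ring

/-- With `b₂ = 0`, `Sᵢ = (b₁−cos φᵢ)² + sin²φᵢ`, and the Jacobian entries
`J₁, J₂, J₃, J₄` of the ratio map, one has
`J₁J₄ − J₂J₃ = 16(1 − b₁²) sin((φ₁−φ₂)/2) sin((φ₂−φ₃)/2) sin((φ₃−φ₁)/2)·S₃`. -/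
theorem jacobian_two_by_two_det_identity (φ₁ φ₂ φ₃ b₁ : ℝ) (S₁ S₂ S₃ J₁ J₂ J₃ J₄ : ℝ)
    (hS₁ : S₁ = (b₁ - Real.cos φ₁) ^ 2 + Real.sin φ₁ ^ 2)
    (hS₂ : S₂ = (b₁ - Real.cos φ₂) ^ 2 + Real.sin φ₂ ^ 2)
    (hS₃ : S₃ = (b₁ - Real.cos φ₃) ^ 2 + Real.sin φ₃ ^ 2)
    (hJ₁ : J₁ = -2 * (b₁ - Real.cos φ₁) * S₃ + 2 * (b₁ - Real.cos φ₃) * S₁)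
    (hJ₂ : J₂ = 2 * Real.sin φ₁ * S₃ - 2 * Real.sin φ₃ * S₁)
    (hJ₃ : J₃ = -2 * (b₁ - Real.cos φ₂) * S₃ + 2 * (b₁ - Real.cos φ₃) * S₂)
    (hJ₄ : J₄ = 2 * Real.sin φ₂ * S₃ - 2 * Real.sin φ₃ * S₂) :
    J₁ * J₄ - J₂ * J₃ =
      16 * (1 - b₁ ^ 2) * Real.sin ((φ₁ - φ₂) / 2) * Real.sin ((φ₂ - φ₃) / 2) *
        Real.sin ((φ₃ - φ₁) / 2) * S₃ := by
  rw [sub_cos_sq_add_sin_sq] at hS₁ hS₂ hS₃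
  subst hJ₁ hJ₂ hJ₃ hJ₄ hS₁ hS₂
  have key := four_mul_sin_half_sub_mul_sin_half_sub_mul_sin_half_sub φ₁ φ₂ φ₃
  rw [hS₃]
  linear_combination (-4 * (1 - b₁ ^ 2) * (1 + b₁ ^ 2 - 2 * b₁ * cos φ₃)) * key
end

section
/- Let φ₁, φ₂, φ₃ be real numbers that are pairwise distinct modulo 2π, and let b₁ ∈ (−1,1), b₂ = 0. Set Sᵢ = (b₁−cos φᵢ)² + sin²φᵢ and let D𝒜̃ be the 2×2 matrix −(1/S₃²)·[[J₁, J₂],[J₃, J₄]] with J₁ = −2(b₁−cos φ₁)S₃ + 2(b₁−cos φ₃)S₁, J₂ = 2 sin φ₁ · S₃ − 2 sin φ₃ · S₁, J₃ = −2(b₁−cos φ₂)S₃ + 2(b₁−cos φ₃)S₂, J₄ = 2 sin φ₂ · S₃ − 2 sin φ₃ · S₂. Then det(D𝒜̃) ≠ 0, i.e., the Jacobian of the ratio map 𝒜̃(b₁,b₂) = (S₁/S₃, S₂/S₃) is invertible. -/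
open Real

theorem sin_half_sub_ne_zero {x y : ℝ} (h : ∀ n : ℤ, x - y ≠ 2 * π * n) :
    Real.sin (x / 2 - y / 2) ≠ 0 := by
  intro h0
  obtain ⟨n, hn⟩ := Real.sin_eq_zero_iff.1 h0
  exact h n (by linarith)

/-- Twice the signed area of a triangle inscribed in the unit circle, as a product of sines. -/
theorem inscribed_triangle_area (x y z : ℝ) :
    (Real.cos y - Real.cos x) * (Real.sin z - Real.sin x)
      - (Real.cos z - Real.cos x) * (Real.sin y - Real.sin x)
      = 4 * Real.sin (x / 2 - y / 2) * Real.sin (y / 2 - z / 2) * Real.sin (z / 2 - x / 2) := by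
  have hc : ∀ t : ℝ, Real.cos t = Real.cos (t / 2) ^ 2 - Real.sin (t / 2) ^ 2 := fun t => by
    rw [← Real.cos_two_mul']; ring_nf
  have hs : ∀ t : ℝ, Real.sin t = 2 * Real.sin (t / 2) * Real.cos (t / 2) := fun t => by
    rw [← Real.sin_two_mul]; ring_nf
  have h1 : ∀ t : ℝ, 1 = Real.cos (t / 2) ^ 2 + Real.sin (t / 2) ^ 2 := fun t =>
    (Real.cos_sq_add_sin_sq _).symm
  calc
    _ = 1 * (Real.cos y * Real.sin z - Real.cos z * Real.sin y)
        - 1 * (Real.cos x * Real.sin z - Real.cos z * Real.sin x)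
        + 1 * (Real.cos x * Real.sin y - Real.cos y * Real.sin x) := by ring
    _ = (Real.cos (x / 2) ^ 2 + Real.sin (x / 2) ^ 2)
          * (Real.cos y * Real.sin z - Real.cos z * Real.sin y)
        - (Real.cos (y / 2) ^ 2 + Real.sin (y / 2) ^ 2)
          * (Real.cos x * Real.sin z - Real.cos z * Real.sin x)
        + (Real.cos (z / 2) ^ 2 + Real.sin (z / 2) ^ 2)
          * (Real.cos x * Real.sin y - Real.cos y * Real.sin x) := by
      rw [← h1 x, ← h1 y, ← h1 z]
    _ = _ := by
      rw [hc x, hc y, hc z, hs x, hs y, hs z, Real.sin_sub, Real.sin_sub, Real.sin_sub]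
      ring

/-- For measurement angles pairwise distinct modulo `2π` and anomaly center `(b₁,0)` with
`b₁ ∈ (−1,1)`, the Jacobian `D𝒜̃ = −(1/S₃²)·[[J₁,J₂],[J₃,J₄]]` of the ratio map
`𝒜̃(b₁,b₂) = (S₁/S₃, S₂/S₃)` has nonzero determinant, i.e. it is invertible. -/
theorem jacobian_ratio_map_invertible (φ₁ φ₂ φ₃ b₁ : ℝ)
    (h₁₂ : ∀ n : ℤ, φ₁ - φ₂ ≠ 2 * π * n)
    (h₂₃ : ∀ n : ℤ, φ₂ - φ₃ ≠ 2 * π * n)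
    (h₃₁ : ∀ n : ℤ, φ₃ - φ₁ ≠ 2 * π * n)
    (hb₁ : -1 < b₁) (hb₁' : b₁ < 1)
    (S₁ S₂ S₃ J₁ J₂ J₃ J₄ : ℝ)
    (hS₁ : S₁ = (b₁ - Real.cos φ₁) ^ 2 + Real.sin φ₁ ^ 2)
    (hS₂ : S₂ = (b₁ - Real.cos φ₂) ^ 2 + Real.sin φ₂ ^ 2)
    (hS₃ : S₃ = (b₁ - Real.cos φ₃) ^ 2 + Real.sin φ₃ ^ 2)
    (hJ₁ : J₁ = -2 * (b₁ - Real.cos φ₁) * S₃ + 2 * (b₁ - Real.cos φ₃) * S₁)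
    (hJ₂ : J₂ = 2 * Real.sin φ₁ * S₃ - 2 * Real.sin φ₃ * S₁)
    (hJ₃ : J₃ = -2 * (b₁ - Real.cos φ₂) * S₃ + 2 * (b₁ - Real.cos φ₃) * S₂)
    (hJ₄ : J₄ = 2 * Real.sin φ₂ * S₃ - 2 * Real.sin φ₃ * S₂) :
    Matrix.det ((-(1 / S₃ ^ 2)) • !![J₁, J₂; J₃, J₄]) ≠ 0 := by
  have hS : ∀ t : ℝ, (b₁ - Real.cos t) ^ 2 + Real.sin t ^ 2 = 1 + b₁ ^ 2 - 2 * b₁ * Real.cos t :=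
    fun t => by linear_combination Real.sin_sq_add_cos_sq t
  have hb : 0 < 1 - b₁ ^ 2 := by nlinarith
  have hS₃0 : S₃ ≠ 0 := by
    rw [hS₃]
    intro h
    have hc : b₁ - Real.cos φ₃ = 0 := by nlinarith [sq_nonneg (b₁ - Real.cos φ₃)]
    nlinarith [Real.sin_sq_add_cos_sq φ₃, sq_nonneg (b₁ - Real.cos φ₃)]
  have harea := inscribed_triangle_area φ₁ φ₂ φ₃
  set P := 4 * Real.sin (φ₁ / 2 - φ₂ / 2) * Real.sin (φ₂ / 2 - φ₃ / 2)
    * Real.sin (φ₃ / 2 - φ₁ / 2)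
  have hP0 : P ≠ 0 :=
    mul_ne_zero (mul_ne_zero (mul_ne_zero four_ne_zero (sin_half_sub_ne_zero h₁₂))
      (sin_half_sub_ne_zero h₂₃)) (sin_half_sub_ne_zero h₃₁)
  rw [hS] at hS₁ hS₂ hS₃
  have hdet : J₁ * J₄ - J₂ * J₃ = 4 * S₃ * (1 - b₁ ^ 2) * P := by
    have hcof : J₁ * J₄ - J₂ * J₃ = 4 * S₃ *
        (S₃ * ((b₁ - Real.cos φ₂) * Real.sin φ₁ - (b₁ - Real.cos φ₁) * Real.sin φ₂)
        + S₂ * ((b₁ - Real.cos φ₁) * Real.sin φ₃ - (b₁ - Real.cos φ₃) * Real.sin φ₁)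
        + S₁ * ((b₁ - Real.cos φ₃) * Real.sin φ₂ - (b₁ - Real.cos φ₂) * Real.sin φ₃)) := by
      rw [hJ₁, hJ₂, hJ₃, hJ₄]; ring
    rw [hcof, ← harea, mul_assoc (4 * S₃)]
    congr 1
    rw [hS₁, hS₂, hS₃]
    ring
  rw [Matrix.det_smul, Matrix.det_fin_two_of, hdet]
  exact mul_ne_zero (pow_ne_zero _ (neg_ne_zero.2 (one_div_ne_zero (pow_ne_zero _ hS₃0))))
    (mul_ne_zero (mul_ne_zero (mul_ne_zero four_ne_zero hS₃0) hb.ne') hP0)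
end

section
/- Let φ₁, φ₂, φ₃ be real numbers that are pairwise distinct modulo 2π, and let the anomaly center be (b₁, 0) with b₁ ∈ (−1,1). Set Sᵢ = (b₁−cos φᵢ)² + sin²φᵢ, and let D𝒜̃ be the Jacobian at (b₁,0) of the map 𝒜̃(b₁,b₂) = (S₁(b₁,b₂)/S₃(b₁,b₂), S₂(b₁,b₂)/S₃(b₁,b₂)), where Sᵢ(b₁,b₂) = (b₁−cos φᵢ)² + (b₂−sin φᵢ)². Then D𝒜̃ is invertible and its inverse satisfies ‖D𝒜̃⁻¹‖₁ ≤ [2√2 / ((1−b₁²)·|sin((φ₁−φ₂)/2) sin((φ₂−φ₃)/2) sin((φ₃−φ₁)/2)|)] · S₃^{3/2} · max{S₁ + √(S₁S₃), S₂ + √(S₂S₃)}, where ‖·‖₁ denotes the operator norm induced by the ℓ¹ vector norm. -/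
open Real

/-- `ℝ²` equipped with the `ℓ¹` norm. -/
abbrev L1Plane := PiLp 1 (fun _ : Fin 2 => ℝ)

/-- The ratio map `𝒜̃(b₁,b₂) = (S₁(b₁,b₂)/S₃(b₁,b₂), S₂(b₁,b₂)/S₃(b₁,b₂))`, where
`Sᵢ(b₁,b₂) = (b₁−cos φᵢ)² + (b₂−sin φᵢ)²`, viewed as a map between copies of `ℝ²`
carrying the `ℓ¹` norm. -/
noncomputable def ratioMap (φ₁ φ₂ φ₃ : ℝ) (x : L1Plane) : L1Plane :=
  (WithLp.equiv 1 (Fin 2 → ℝ)).symm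
    ![((x 0 - Real.cos φ₁) ^ 2 + (x 1 - Real.sin φ₁) ^ 2) /
        ((x 0 - Real.cos φ₃) ^ 2 + (x 1 - Real.sin φ₃) ^ 2),
      ((x 0 - Real.cos φ₂) ^ 2 + (x 1 - Real.sin φ₂) ^ 2) /
        ((x 0 - Real.cos φ₃) ^ 2 + (x 1 - Real.sin φ₃) ^ 2)]

/-- The endomorphism of `L1Plane` with matrix `!![p, q; r, s]`. -/
noncomputable def matrixMap (p q r s : ℝ) : L1Plane →L[ℝ] L1Plane :=
  LinearMap.toContinuousLinearMap
    { toFun := fun v => WithLp.toLp 1 ![p * v 0 + q * v 1, r * v 0 + s * v 1]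
      map_add' := fun v w => by
        ext i
        fin_cases i <;> simp <;> ring
      map_smul' := fun c v => by
        ext i
        fin_cases i <;> simp <;> ring }

@[simp]
lemma matrixMap_apply_zero (p q r s : ℝ) (v : L1Plane) :
    matrixMap p q r s v 0 = p * v 0 + q * v 1 := rfl

@[simp]
lemma matrixMap_apply_one (p q r s : ℝ) (v : L1Plane) :
    matrixMap p q r s v 1 = r * v 0 + s * v 1 := rfl

lemma matrixMap_comp (p q r s p' q' r' s' : ℝ) :
    (matrixMap p q r s).comp (matrixMap p' q' r' s') =
      matrixMap (p * p' + q * r') (p * q' + q * s') (r * p' + s * r') (r * q' + s * s') := by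
  ext v i
  fin_cases i <;> simp <;> ring

lemma matrixMap_one : matrixMap 1 0 0 1 = ContinuousLinearMap.id ℝ L1Plane := by
  ext v i
  fin_cases i <;> simp

lemma norm_matrixMap_le {p q r s C : ℝ} (h₀ : |p| + |r| ≤ C) (h₁ : |q| + |s| ≤ C) :
    ‖matrixMap p q r s‖ ≤ C := by
  refine ContinuousLinearMap.opNorm_le_bound _ ((by positivity : 0 ≤ |p| + |r|).trans h₀) fun v => ?_
  simp only [PiLp.norm_eq_of_L1, Fin.sum_univ_two, matrixMap_apply_zero, matrixMap_apply_one,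
    Real.norm_eq_abs]
  calc |p * v 0 + q * v 1| + |r * v 0 + s * v 1|
      ≤ (|p| * |v 0| + |q| * |v 1|) + (|r| * |v 0| + |s| * |v 1|) := by
        simp only [← abs_mul]
        exact add_le_add (abs_add_le _ _) (abs_add_le _ _)
    _ = (|p| + |r|) * |v 0| + (|q| + |s|) * |v 1| := by ring
    _ ≤ C * |v 0| + C * |v 1| := by gcongr
    _ = C * (|v 0| + |v 1|) := by ring

lemma matrixMap_comp_inverse {p q r s d : ℝ} (hd : d ≠ 0) (h : p * s - q * r = d) :
    (matrixMap p q r s).comp (matrixMap (s / d) (-q / d) (-r / d) (p / d)) =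
      ContinuousLinearMap.id ℝ L1Plane := by
  rw [matrixMap_comp, ← matrixMap_one]
  congr 1 <;> field_simp <;> first | ring1 | linear_combination h

lemma matrixMap_inverse_comp {p q r s d : ℝ} (hd : d ≠ 0) (h : p * s - q * r = d) :
    (matrixMap (s / d) (-q / d) (-r / d) (p / d)).comp (matrixMap p q r s) =
      ContinuousLinearMap.id ℝ L1Plane := by
  rw [matrixMap_comp, ← matrixMap_one]
  congr 1 <;> field_simp <;> first | ring1 | linear_combination h

lemma hasFDerivAt_sqDist (c s : ℝ) (x : L1Plane) :
    HasFDerivAt (fun y : L1Plane => (y 0 - c) ^ 2 + (y 1 - s) ^ 2)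
      ((2 * (x 0 - c)) • PiLp.proj 1 (fun _ : Fin 2 => ℝ) 0 +
        (2 * (x 1 - s)) • PiLp.proj 1 (fun _ : Fin 2 => ℝ) 1 : L1Plane →L[ℝ] ℝ) x := by
  have h (i : Fin 2) : HasFDerivAt (fun y : L1Plane => y i)
      (PiLp.proj 1 (fun _ : Fin 2 => ℝ) i : L1Plane →L[ℝ] ℝ) x :=
    (PiLp.proj 1 (fun _ : Fin 2 => ℝ) i : L1Plane →L[ℝ] ℝ).hasFDerivAt
  refine ((((h 0).sub_const c).pow 2).add (((h 1).sub_const s).pow 2)).congr_fderiv ?_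
  ext v
  simp

lemma hasFDerivAt_div_of_ne_zero {E : Type*} [NormedAddCommGroup E] [NormedSpace ℝ E]
    {f g : E → ℝ} {f' g' : E →L[ℝ] ℝ} {x : E} (hf : HasFDerivAt f f' x)
    (hg : HasFDerivAt g g' x) (hx : g x ≠ 0) :
    HasFDerivAt (fun y => f y / g y) ((1 / g x ^ 2) • (g x • f' - f x • g')) x := by
  simp only [div_eq_mul_inv]
  refine (hf.mul ((hasDerivAt_inv hx).comp_hasFDerivAt x hg)).congr_fderiv ?_
  ext v
  simp
  field_simp
  ring

lemma hasFDerivAt_ratioMap (φ₁ φ₂ φ₃ : ℝ) {b T₁ T₂ T₃ : ℝ}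
    (hT₁ : T₁ = (b - cos φ₁) ^ 2 + sin φ₁ ^ 2)
    (hT₂ : T₂ = (b - cos φ₂) ^ 2 + sin φ₂ ^ 2)
    (hT₃ : T₃ = (b - cos φ₃) ^ 2 + sin φ₃ ^ 2) (h : T₃ ≠ 0) :
    HasFDerivAt (ratioMap φ₁ φ₂ φ₃)
      (matrixMap
        (2 * (T₃ * (b - cos φ₁) - T₁ * (b - cos φ₃)) / T₃ ^ 2)
        (2 * (T₁ * sin φ₃ - T₃ * sin φ₁) / T₃ ^ 2)
        (2 * (T₃ * (b - cos φ₂) - T₂ * (b - cos φ₃)) / T₃ ^ 2)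
        (2 * (T₂ * sin φ₃ - T₃ * sin φ₂) / T₃ ^ 2))
      ((WithLp.equiv 1 (Fin 2 → ℝ)).symm ![b, 0]) := by
  set x : L1Plane := (WithLp.equiv 1 (Fin 2 → ℝ)).symm ![b, 0]
  have hx0 : x 0 = b := rfl
  have hx1 : x 1 = 0 := rfl
  have h₃ : (x 0 - cos φ₃) ^ 2 + (x 1 - sin φ₃) ^ 2 ≠ 0 := by
    rw [hx0, hx1]
    convert h using 1
    rw [hT₃]
    ring
  rw [← hasFDerivWithinAt_univ, hasFDerivWithinAt_piLp]
  intro i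
  fin_cases i
  · refine ((hasFDerivAt_div_of_ne_zero (hasFDerivAt_sqDist (cos φ₁) (sin φ₁) x)
      (hasFDerivAt_sqDist (cos φ₃) (sin φ₃) x) h₃).congr_fderiv ?_).hasFDerivWithinAt
    ext v
    simp [hx0, hx1, ← hT₁, ← hT₃]
    field_simp
    ring
  · refine ((hasFDerivAt_div_of_ne_zero (hasFDerivAt_sqDist (cos φ₂) (sin φ₂) x)
      (hasFDerivAt_sqDist (cos φ₃) (sin φ₃) x) h₃).congr_fderiv ?_).hasFDerivWithinAt
    ext v
    simp [hx0, hx1, ← hT₂, ← hT₃]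
    field_simp
    ring

lemma sq_sub_cos_add_sq_sin (b φ : ℝ) :
    (b - cos φ) ^ 2 + sin φ ^ 2 = 1 + b ^ 2 - 2 * b * cos φ := by
  linear_combination sin_sq_add_cos_sq φ

lemma sq_sub_cos_add_sq_sin_pos {b : ℝ} (φ : ℝ) (h : -1 < b) (h' : b < 1) :
    0 < (b - cos φ) ^ 2 + sin φ ^ 2 := by
  rw [sq_sub_cos_add_sq_sin]
  rcases le_total 0 b with hb | hb
  · nlinarith [mul_nonneg hb (sub_nonneg.mpr (cos_le_one φ))]
  · nlinarith [mul_nonneg (neg_nonneg.mpr hb) (neg_le_iff_add_nonneg.mp (neg_one_le_cos φ))]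

lemma sum_sin_sub_eq (φ₁ φ₂ φ₃ : ℝ) :
    (cos φ₁ * sin φ₂ - sin φ₁ * cos φ₂) + (cos φ₂ * sin φ₃ - sin φ₂ * cos φ₃) +
        (cos φ₃ * sin φ₁ - sin φ₃ * cos φ₁) =
      4 * (sin ((φ₁ - φ₂) / 2) * sin ((φ₂ - φ₃) / 2) * sin ((φ₃ - φ₁) / 2)) := by
  obtain ⟨x, hx⟩ : ∃ x, x = (φ₁ - φ₂) / 2 := ⟨_, rfl⟩
  obtain ⟨y, hy⟩ : ∃ y, y = (φ₂ - φ₃) / 2 := ⟨_, rfl⟩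
  have e₁ : sin (2 * x) = sin φ₁ * cos φ₂ - cos φ₁ * sin φ₂ := by
    rw [← sin_sub, hx]; ring_nf
  have e₂ : sin (2 * y) = sin φ₂ * cos φ₃ - cos φ₂ * sin φ₃ := by
    rw [← sin_sub, hy]; ring_nf
  have e₃ : sin (2 * (x + y)) = sin φ₁ * cos φ₃ - cos φ₁ * sin φ₃ := by
    rw [← sin_sub, hx, hy]; ring_nf
  have e₄ : sin ((φ₃ - φ₁) / 2) = -sin (x + y) := by
    rw [← sin_neg, hx, hy]; ring_nf
  rw [← hx, ← hy, e₄]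
  rw [sin_two_mul] at e₁ e₂ e₃
  rw [sin_add, cos_add] at e₃
  rw [sin_add]
  linear_combination e₁ + e₂ - e₃ + 2 * sin x * cos x * sin_sq_add_cos_sq y +
    2 * sin y * cos y * sin_sq_add_cos_sq x

lemma sin_half_ne_zero {x : ℝ} (h : ∀ n : ℤ, x ≠ 2 * π * n) : sin (x / 2) ≠ 0 := by
  rw [Ne, sin_eq_zero_iff]
  rintro ⟨n, hn⟩
  exact h n (by linear_combination -2 * hn)

lemma abs_mul_sub_mul_le {a c S T : ℝ} (ha : a ^ 2 ≤ S) (hc : c ^ 2 ≤ T) :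
    |T * a - S * c| ≤ √T * (S + √(S * T)) := by
  have hS : 0 ≤ S := (sq_nonneg a).trans ha
  have hT : 0 ≤ T := (sq_nonneg c).trans hc
  have ha' : |a| ≤ √S := abs_le_sqrt ha
  have hc' : |c| ≤ √T := abs_le_sqrt hc
  calc |T * a - S * c| ≤ |T * a| + |S * c| := abs_sub _ _
    _ = T * |a| + S * |c| := by rw [abs_mul, abs_mul, abs_of_nonneg hS, abs_of_nonneg hT]
    _ ≤ T * √S + S * √T := by gcongr
    _ = √T * (S + √(S * T)) := by
      rw [sqrt_mul hS]
      linear_combination -√S * sq_sqrt hT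

lemma abs_add_abs_div_le {u v T S P Q M : ℝ} (hT : 0 < T) (hP : 0 < P) (hQ : 0 < Q)
    (hu : |u| ≤ √T * (S + √(S * T))) (hv : |v| ≤ √T * (S + √(S * T)))
    (hM : S + √(S * T) ≤ M) {d : ℝ} (hd : |d| = 16 * (P * Q) / T ^ 3) :
    |2 * u / T ^ 2 / d| + |2 * v / T ^ 2 / d| ≤
      2 * √2 / (P * Q) * (T ^ ((3 : ℝ) / 2) * M) := by
  have hT32 : T ^ ((3 : ℝ) / 2) = T * √T := by
    rw [show (3 : ℝ) / 2 = 1 + 1 / 2 by norm_num, rpow_add hT, rpow_one, ← sqrt_eq_rpow]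
  have h2 : 1 ≤ √2 := one_le_sqrt.mpr one_le_two
  have key : |u| + |v| ≤ 2 * (√T * M) := by
    have := mul_le_mul_of_nonneg_left hM (sqrt_nonneg T)
    linarith
  have hM0 : 0 ≤ √T * M := by
    linarith [abs_nonneg u, abs_nonneg v]
  rw [hT32]
  simp only [abs_div, abs_mul, hd, abs_of_pos (pow_pos hT 2), abs_two]
  calc 2 * |u| / T ^ 2 / (16 * (P * Q) / T ^ 3) + 2 * |v| / T ^ 2 / (16 * (P * Q) / T ^ 3)
      = T / (8 * (P * Q)) * (|u| + |v|) := by field_simp; ring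
    _ ≤ T / (8 * (P * Q)) * (2 * (√T * M)) := by gcongr
    _ = 1 / 4 / (P * Q) * (T * (√T * M)) := by field_simp; ring
    _ ≤ 2 * √2 / (P * Q) * (T * (√T * M)) := by
      gcongr
      linarith
    _ = 2 * √2 / (P * Q) * (T * √T * M) := by ring

/-- Stability estimate: for measurement angles pairwise distinct modulo `2π` and anomaly
center `(b₁,0)` with `b₁ ∈ (−1,1)`, the Jacobian `D𝒜̃` of the ratio map at `(b₁,0)` is
invertible and the `ℓ¹`-induced operator norm of its inverse satisfies
`‖D𝒜̃⁻¹‖₁ ≤ [2√2/((1−b₁²)|sin((φ₁−φ₂)/2) sin((φ₂−φ₃)/2) sin((φ₃−φ₁)/2)|)]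
  · S₃^{3/2} · max{S₁ + √(S₁S₃), S₂ + √(S₂S₃)}`. -/
theorem inverse_jacobian_ratio_map_bound (φ₁ φ₂ φ₃ b₁ : ℝ)
    (h₁₂ : ∀ n : ℤ, φ₁ - φ₂ ≠ 2 * π * n)
    (h₂₃ : ∀ n : ℤ, φ₂ - φ₃ ≠ 2 * π * n)
    (h₃₁ : ∀ n : ℤ, φ₃ - φ₁ ≠ 2 * π * n)
    (hb₁ : -1 < b₁) (hb₁' : b₁ < 1)
    (S₁ S₂ S₃ : ℝ)
    (hS₁ : S₁ = (b₁ - Real.cos φ₁) ^ 2 + Real.sin φ₁ ^ 2)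
    (hS₂ : S₂ = (b₁ - Real.cos φ₂) ^ 2 + Real.sin φ₂ ^ 2)
    (hS₃ : S₃ = (b₁ - Real.cos φ₃) ^ 2 + Real.sin φ₃ ^ 2) :
    ∃ L : L1Plane →L[ℝ] L1Plane,
      (fderiv ℝ (ratioMap φ₁ φ₂ φ₃)
            ((WithLp.equiv 1 (Fin 2 → ℝ)).symm ![b₁, 0])).comp L =
          ContinuousLinearMap.id ℝ L1Plane ∧
      L.comp (fderiv ℝ (ratioMap φ₁ φ₂ φ₃)
            ((WithLp.equiv 1 (Fin 2 → ℝ)).symm ![b₁, 0])) =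
          ContinuousLinearMap.id ℝ L1Plane ∧
      ‖L‖ ≤
        2 * Real.sqrt 2 /
            ((1 - b₁ ^ 2) *
              |Real.sin ((φ₁ - φ₂) / 2) * Real.sin ((φ₂ - φ₃) / 2) *
                Real.sin ((φ₃ - φ₁) / 2)|) *
          (S₃ ^ ((3 : ℝ) / 2) *
            max (S₁ + Real.sqrt (S₁ * S₃)) (S₂ + Real.sqrt (S₂ * S₃))) := by
  have hT : 0 < S₃ := hS₃ ▸ sq_sub_cos_add_sq_sin_pos φ₃ hb₁ hb₁'
  have hP : 0 < 1 - b₁ ^ 2 := by nlinarith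
  set Q := sin ((φ₁ - φ₂) / 2) * sin ((φ₂ - φ₃) / 2) * sin ((φ₃ - φ₁) / 2) with hQ
  have hQ0 : Q ≠ 0 := mul_ne_zero
    (mul_ne_zero (sin_half_ne_zero h₁₂) (sin_half_ne_zero h₂₃)) (sin_half_ne_zero h₃₁)
  set d := 16 * ((1 - b₁ ^ 2) * Q) / S₃ ^ 3 with hd
  have hd0 : d ≠ 0 := by positivity
  have hd_abs : |d| = 16 * ((1 - b₁ ^ 2) * |Q|) / S₃ ^ 3 := by
    rw [hd, abs_div, abs_mul, abs_mul, abs_of_pos hP, abs_of_pos (pow_pos hT 3)]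
    norm_num
  have hdet :
      2 * (S₃ * (b₁ - cos φ₁) - S₁ * (b₁ - cos φ₃)) / S₃ ^ 2 *
          (2 * (S₂ * sin φ₃ - S₃ * sin φ₂) / S₃ ^ 2) -
        2 * (S₁ * sin φ₃ - S₃ * sin φ₁) / S₃ ^ 2 *
          (2 * (S₃ * (b₁ - cos φ₂) - S₂ * (b₁ - cos φ₃)) / S₃ ^ 2) = d := by
    have e := sum_sin_sub_eq φ₁ φ₂ φ₃
    rw [← hQ] at e
    have e₁ := hS₁.trans (sq_sub_cos_add_sq_sin b₁ φ₁)
    have e₂ := hS₂.trans (sq_sub_cos_add_sq_sin b₁ φ₂)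
    have e₃ := hS₃.trans (sq_sub_cos_add_sq_sin b₁ φ₃)
    have key : S₁ * ((b₁ - cos φ₃) * sin φ₂ - (b₁ - cos φ₂) * sin φ₃) +
        S₂ * ((b₁ - cos φ₁) * sin φ₃ - (b₁ - cos φ₃) * sin φ₁) +
        S₃ * ((b₁ - cos φ₂) * sin φ₁ - (b₁ - cos φ₁) * sin φ₂) =
          4 * ((1 - b₁ ^ 2) * Q) := by
      rw [e₁, e₂, e₃]
      linear_combination (1 - b₁ ^ 2) * e
    rw [hd]
    field_simp
    linear_combination 4 * S₃ * key
  have h₁ (φ S : ℝ) (hS : S = (b₁ - cos φ) ^ 2 + sin φ ^ 2) :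
      |S₃ * (b₁ - cos φ) - S * (b₁ - cos φ₃)| ≤ √S₃ * (S + √(S * S₃)) :=
    abs_mul_sub_mul_le (by rw [hS]; linarith [sq_nonneg (sin φ)])
      (by rw [hS₃]; linarith [sq_nonneg (sin φ₃)])
  have h₂ (φ S : ℝ) (hS : S = (b₁ - cos φ) ^ 2 + sin φ ^ 2) :
      |S * sin φ₃ - S₃ * sin φ| ≤ √S₃ * (S + √(S * S₃)) := by
    rw [abs_sub_comm]
    exact abs_mul_sub_mul_le (by rw [hS]; linarith [sq_nonneg (b₁ - cos φ)])
      (by rw [hS₃]; linarith [sq_nonneg (b₁ - cos φ₃)])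
  rw [(hasFDerivAt_ratioMap φ₁ φ₂ φ₃ hS₁ hS₂ hS₃ hT.ne').fderiv]
  refine ⟨_, matrixMap_comp_inverse hd0 hdet, matrixMap_inverse_comp hd0 hdet,
    norm_matrixMap_le ?_ ?_⟩
  · rw [neg_div, abs_neg]
    exact abs_add_abs_div_le hT hP (abs_pos.mpr hQ0) (h₂ φ₂ S₂ hS₂) (h₁ φ₂ S₂ hS₂)
      (le_max_right _ _) hd_abs
  · rw [neg_div, abs_neg]
    exact abs_add_abs_div_le hT hP (abs_pos.mpr hQ0) (h₂ φ₁ S₁ hS₁) (h₁ φ₁ S₁ hS₁)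
      (le_max_left _ _) hd_abs
end
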